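/- Let G = (V, E) be a double-arborescence, let ≺ be a treelike orientation of G, and let r be a root of G (a vertex adjacent to all other vertices, so that r is comparable under ≺ to every other vertex). Let A = {a ∈ V : a ⪯ r} and B = {a ∈ V : r ⪯ a}. Then the induced subgraph G[A] is an arborescence (the restriction of ≺ to A is a treelike orientation of G[A] with greatest element r), and the induced subgraph G[B] is an arborescence (the restriction of ≺ to B is a treelike orientation of G[B] with least element r). -/

import Mathlib

/-- A strict partial order (irreflexive and transitive relation). -/
def IsStrictPO {V : Type*} (lt : V → V → Prop) : Prop :=
  (∀ a, ¬ lt a a) ∧ ∀ a b c, lt a b → lt b c → lt a c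

/-- `b` covers `a` in the strict order `lt`. -/
def CovRel {V : Type*} (lt : V → V → Prop) (a b : V) : Prop :=
  lt a b ∧ ∀ c, lt a c → ¬ lt c b

/-- The Hasse diagram of a strict order: vertices joined iff one covers the other. -/
def hasseGraph {V : Type*} (lt : V → V → Prop) : SimpleGraph V :=
  SimpleGraph.fromRel (CovRel lt)

/-- `lt` is a treelike orientation of `G`: a transitive orientation
(a strict partial order in which distinct vertices are adjacent iff comparable)
whose Hasse diagram is a tree. -/
def IsTreelikeOrientation {V : Type*} (G : SimpleGraph V) (lt : V → V → Prop) : Prop :=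
  IsStrictPO lt ∧ (∀ a b : V, G.Adj a b ↔ (lt a b ∨ lt b a)) ∧ (hasseGraph lt).IsTree

/-- A treelike comparability graph: a graph admitting a treelike orientation. -/
def IsTreelikeComparability {V : Type*} (G : SimpleGraph V) : Prop :=
  ∃ lt : V → V → Prop, IsTreelikeOrientation G lt

/-- A double-arborescence: a treelike comparability graph with an all-adjacent vertex. -/
def IsDoubleArborescence {V : Type*} (G : SimpleGraph V) : Prop :=
  IsTreelikeComparability G ∧ ∃ r : V, ∀ v : V, v ≠ r → G.Adj r v

/-- An arborescence: a treelike comparability graph admitting a treelike orientation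
in which some vertex is the greatest or the least element. -/
def IsArborescence {V : Type*} (G : SimpleGraph V) : Prop :=
  ∃ lt : V → V → Prop, IsTreelikeOrientation G lt ∧
    ∃ r : V, (∀ v : V, v ≠ r → lt v r) ∨ (∀ v : V, v ≠ r → lt r v)

/-- `G` contains an induced path on four vertices. -/
def HasInducedP4 {V : Type*} (G : SimpleGraph V) : Prop :=
  ∃ a b c d : V, a ≠ b ∧ a ≠ c ∧ a ≠ d ∧ b ≠ c ∧ b ≠ d ∧ c ≠ d ∧
    G.Adj a b ∧ G.Adj b c ∧ G.Adj c d ∧ ¬ G.Adj a c ∧ ¬ G.Adj a d ∧ ¬ G.Adj b d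

/-- `G` is `P4`-free. -/
def P4Free {V : Type*} (G : SimpleGraph V) : Prop := ¬ HasInducedP4 G

/-- `G` contains an induced cycle on four vertices. -/
def HasInducedC4 {V : Type*} (G : SimpleGraph V) : Prop :=
  ∃ a b c d : V, a ≠ b ∧ a ≠ c ∧ a ≠ d ∧ b ≠ c ∧ b ≠ d ∧ c ≠ d ∧
    G.Adj a b ∧ G.Adj b c ∧ G.Adj c d ∧ G.Adj d a ∧ ¬ G.Adj a c ∧ ¬ G.Adj b d

/-- `G` is `C4`-free. -/
def C4Free {V : Type*} (G : SimpleGraph V) : Prop := ¬ HasInducedC4 G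

theorem IsStrictPO.wellFounded {V : Type*} [Finite V] {lt : V → V → Prop}
    (h : IsStrictPO lt) : WellFounded lt :=
  haveI : Std.Irrefl lt := ⟨h.1⟩
  haveI : IsTrans V lt := ⟨h.2⟩
  Finite.wellFounded_of_trans_of_irrefl lt

theorem IsStrictPO.swap {V : Type*} {lt : V → V → Prop} (h : IsStrictPO lt) :
    IsStrictPO (fun x y => lt y x) :=
  ⟨h.1, fun a b c hab hbc => h.2 c b a hbc hab⟩

theorem IsStrictPO.comap {V W : Type*} {lt : V → V → Prop} (h : IsStrictPO lt) (f : W → V) :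
    IsStrictPO (fun x y => lt (f x) (f y)) :=
  ⟨fun a => h.1 (f a), fun a b c => h.2 (f a) (f b) (f c)⟩

theorem hasseGraph_swap {V : Type*} (lt : V → V → Prop) :
    hasseGraph (fun x y => lt y x) = hasseGraph lt := by
  ext a b
  simp only [hasseGraph, SimpleGraph.fromRel_adj, CovRel]
  grind

theorem IsTreelikeOrientation.swap {V : Type*} {G : SimpleGraph V} {lt : V → V → Prop}
    (h : IsTreelikeOrientation G lt) : IsTreelikeOrientation G (fun x y => lt y x) :=
  ⟨h.1.swap, fun a b => (h.2.1 a b).trans or_comm, (hasseGraph_swap lt).symm ▸ h.2.2⟩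

/-- The Hasse diagram of a finite order with greatest element is connected. -/
theorem hasseGraph_connected_of_greatest {V : Type*} [Finite V] {lt : V → V → Prop}
    (h : IsStrictPO lt) (r : V) (hr : ∀ v, v ≠ r → lt v r) : (hasseGraph lt).Connected := by
  have reach : ∀ x, (hasseGraph lt).Reachable x r := by
    intro x
    induction x using h.swap.wellFounded.induction with
    | _ x ih =>
      by_cases hx : x = r
      · rw [hx]
      · obtain ⟨m, hm, hmin⟩ := h.wellFounded.has_min {y | lt x y} ⟨r, hr x hx⟩
        have hadj : (hasseGraph lt).Adj x m := by
          refine (SimpleGraph.fromRel_adj _ _ _).2 ⟨?_, Or.inl ⟨hm, hmin⟩⟩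
          rintro rfl
          exact h.1 _ hm
        exact hadj.reachable.trans (ih m hm)
  exact { preconnected := fun x y => (reach x).trans (reach y).symm, nonempty := ⟨r⟩ }

/-- A treelike orientation restricts to a treelike orientation of a principal lower set. -/
theorem IsTreelikeOrientation.induce_lower {V : Type*} [Finite V] {G : SimpleGraph V}
    {lt : V → V → Prop} (h : IsTreelikeOrientation G lt) (r : V) :
    IsTreelikeOrientation (G.induce {a : V | lt a r ∨ a = r}) (fun x y => lt x.1 y.1) := by
  have hpo := h.1.comap (Subtype.val : {a : V | lt a r ∨ a = r} → V)
  refine ⟨hpo, fun a b => h.2.1 a.1 b.1, ?_, ?_⟩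
  · exact hasseGraph_connected_of_greatest hpo ⟨r, Or.inr rfl⟩
      fun v hv => v.2.resolve_right fun e => hv (Subtype.ext e)
  · have cov : ∀ a b : {a : V | lt a r ∨ a = r},
        CovRel (fun x y : {a : V | lt a r ∨ a = r} => lt x.1 y.1) a b → CovRel lt a.1 b.1 := by
      refine fun a b hab => ⟨hab.1, fun c hac hcb => hab.2 ⟨c, Or.inl ?_⟩ hac hcb⟩
      rcases b.2 with hb | hb
      · exact h.1.2 _ _ _ hcb hb
      · exact hb ▸ hcb
    refine (h.2.2.isAcyclic.induce {a : V | lt a r ∨ a = r}).anti ?_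
    intro a b hab
    obtain ⟨hne, hc⟩ := (SimpleGraph.fromRel_adj _ _ _).1 hab
    exact (SimpleGraph.fromRel_adj _ _ _).2
      ⟨fun e => hne (Subtype.ext e), hc.imp (cov a b) (cov b a)⟩

/-- Let `G` be a double-arborescence with treelike orientation `lt` and root `r`,
and let `A = {a : a ⪯ r}` and `B = {a : r ⪯ a}`.  Then `G[A]` is an arborescence
(the restriction of `lt` to `A` is a treelike orientation of `G[A]` with greatest
element `r`) and `G[B]` is an arborescence (the restriction of `lt` to `B` is a
treelike orientation of `G[B]` with least element `r`). -/
theorem doubleArborescence_split_into_arborescences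
    {V : Type*} [Fintype V] (G : SimpleGraph V)
    (hda : IsDoubleArborescence G)
    (lt : V → V → Prop) (hlt : IsTreelikeOrientation G lt)
    (r : V) (hr : ∀ v : V, v ≠ r → G.Adj r v) :
    (IsArborescence (G.induce {a : V | lt a r ∨ a = r}) ∧
      IsTreelikeOrientation (G.induce {a : V | lt a r ∨ a = r})
        (fun x y => lt x.1 y.1) ∧
      ∀ a : {a : V | lt a r ∨ a = r}, a.1 ≠ r → lt a.1 r) ∧
    (IsArborescence (G.induce {a : V | lt r a ∨ a = r}) ∧
      IsTreelikeOrientation (G.induce {a : V | lt r a ∨ a = r})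
        (fun x y => lt x.1 y.1) ∧
      ∀ a : {a : V | lt r a ∨ a = r}, a.1 ≠ r → lt r a.1) := by
  have lower := hlt.induce_lower r
  have upper := (hlt.swap.induce_lower r).swap
  have hA : ∀ a : {a : V | lt a r ∨ a = r}, a.1 ≠ r → lt a.1 r :=
    fun a ha => a.2.resolve_right ha
  have hB : ∀ a : {a : V | lt r a ∨ a = r}, a.1 ≠ r → lt r a.1 :=
    fun a ha => a.2.resolve_right ha
  exact ⟨⟨⟨_, lower, ⟨r, Or.inr rfl⟩, Or.inl fun v hv => hA v fun e => hv (Subtype.ext e)⟩,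
      lower, hA⟩,
    ⟨⟨_, upper, ⟨r, Or.inr rfl⟩, Or.inr fun v hv => hB v fun e => hv (Subtype.ext e)⟩,
      upper, hB⟩⟩
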